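/- For every δ > 0 and every set U ⊆ ℝ² whose closure is contained in the interior of the square [0, √(π+δ)] × [0, √(π+δ)], there exist a smooth nonnegative function K : ℝ² → ℝ whose support is contained in the rectangle [0, √(π+δ)] × [0, 2√(π+δ)], with maximum value less than π + δ, and a Hamiltonian flow φ : ℝ × ℝ² → ℝ² of K, such that for every t ∈ [0,1] the image φᵗ(U) is contained in the interior of the rectangle [0, √(π+δ)] × [0, (1+t)√(π+δ)], and φ¹(U) ∩ U = ∅ (where φᵗ = φ(t, ·)). -/

import Mathlib

noncomputable section

/-- The Hamiltonian vector field of `K : ℝ² → ℝ` with the convention `i_{X_K} ω₀ = −dK`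
for `ω₀ = dx ∧ dy`, namely `X_K = (−∂K/∂y, ∂K/∂x)`. -/
def hamVF (K : ℝ × ℝ → ℝ) (p : ℝ × ℝ) : ℝ × ℝ :=
  (-(fderiv ℝ K p (0, 1)), fderiv ℝ K p (1, 0))

/-- `φ : ℝ × ℝ² → ℝ²` (curried) is a Hamiltonian flow of `K`: `φ(0,p) = p` and
`∂φ/∂t (t,p) = X_K(φ(t,p))` for all `t` and `p`. -/
def IsHamFlow (K : ℝ × ℝ → ℝ) (φ : ℝ → ℝ × ℝ → ℝ × ℝ) : Prop :=
  (∀ p, φ 0 p = p) ∧ ∀ p t, HasDerivAt (fun s => φ s p) (hamVF K (φ t p)) t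

open Set Metric Filter Topology NNReal

/-- A bounded, globally Lipschitz vector field on a Banach space has a global flow. -/
theorem exists_globalFlow_of_lipschitzWith_of_bounded {E : Type*} [NormedAddCommGroup E]
    [NormedSpace ℝ E] [CompleteSpace E] {v : E → E} {C L : ℝ≥0} (hv : LipschitzWith C v)
    (hL : ∀ x, ‖v x‖ ≤ L) :
    ∃ φ : ℝ → E → E, (∀ p, φ 0 p = p) ∧
      ∀ p t, HasDerivAt (fun s => φ s p) (v (φ t p)) t := by
  have local_sol (p : E) (T : ℝ≥0) : ∃ γ : ℝ → E, γ 0 = p ∧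
      ∀ t ∈ Icc (-(T : ℝ)) T, HasDerivWithinAt γ (v (γ t)) (Icc (-(T : ℝ)) T) t := by
    have hPL : IsPicardLindelof (fun _ => v) (tmin := -(T : ℝ)) (tmax := T)
        ⟨0, by simp⟩ p (L * T) 0 L C :=
      IsPicardLindelof.of_time_independent (fun x _ => hL x) hv.lipschitzOnWith (by simp)
    exact hPL.exists_eq_forall_mem_Icc_hasDerivWithinAt₀
  choose γ hγ0 hγ using local_sol
  have hderiv (p : E) (T : ℝ≥0) (t : ℝ) (ht : t ∈ Ioo (-(T : ℝ)) T) :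
      HasDerivAt (γ p T) (v (γ p T t)) t :=
    (hγ p T t (Ioo_subset_Icc_self ht)).hasDerivAt (Icc_mem_nhds ht.1 ht.2)
  have heq (p : E) {S T : ℝ≥0} (hST : S ≤ T) : EqOn (γ p S) (γ p T) (Ioo (-(S : ℝ)) S) := by
    intro t ht
    have hS : (0 : ℝ) < S := by linarith [ht.1, ht.2]
    have hST' : (S : ℝ) ≤ T := hST
    refine ODE_solution_unique_of_mem_Ioo (v := fun _ => v) (s := fun _ => univ) (K := C)
      (t₀ := 0) (fun _ _ => hv.lipschitzOnWith) ⟨by linarith, hS⟩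
      (fun s hs => ⟨hderiv p S s hs, mem_univ _⟩)
      (fun s hs => ⟨hderiv p T s ⟨by linarith [hs.1], by linarith [hs.2]⟩, mem_univ _⟩)
      ((hγ0 p S).trans (hγ0 p T).symm) ht
  have mem_Ioo_self (t : ℝ) : t ∈ Ioo (-((‖t‖₊ + 1 : ℝ≥0) : ℝ)) (‖t‖₊ + 1 : ℝ≥0) := by
    rw [mem_Ioo, ← abs_lt]
    simp
  refine ⟨fun t p => γ p (‖t‖₊ + 1) t, fun p => hγ0 p _, fun p t => ?_⟩
  refine (hderiv p _ t (mem_Ioo_self t)).congr_of_eventuallyEq ?_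
  filter_upwards [Ioo_mem_nhds (mem_Ioo_self t).1 (mem_Ioo_self t).2] with s hs
  rcases le_total (‖s‖₊ + 1) (‖t‖₊ + 1) with h | h
  · exact heq p h (mem_Ioo_self s)
  · exact (heq p h hs).symm

theorem contDiff_hamVF {K : ℝ × ℝ → ℝ} (hK : ContDiff ℝ (⊤ : ℕ∞) K) :
    ContDiff ℝ 1 (hamVF K) := by
  have h : ContDiff ℝ 1 (fderiv ℝ K) := hK.fderiv_right (by norm_cast)
  exact (h.clm_apply contDiff_const).neg.prodMk (h.clm_apply contDiff_const)

theorem hasCompactSupport_hamVF {K : ℝ × ℝ → ℝ} (hK : HasCompactSupport K) :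
    HasCompactSupport (hamVF K) := by
  refine (hK.fderiv (𝕜 := ℝ)).mono fun p hp h => hp ?_
  simp only [hamVF, h]
  simp

/-- A smooth compactly supported Hamiltonian on the plane has a global flow. -/
theorem exists_isHamFlow {K : ℝ × ℝ → ℝ} (hK : ContDiff ℝ (⊤ : ℕ∞) K)
    (hc : HasCompactSupport K) : ∃ φ, IsHamFlow K φ := by
  obtain ⟨C, hC⟩ := (contDiff_hamVF hK).lipschitzWith_of_hasCompactSupport (hasCompactSupport_hamVF hc) one_ne_zero
  obtain ⟨L, hL⟩ := (contDiff_hamVF hK).continuous.bounded_above_of_compact_support (hasCompactSupport_hamVF hc)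
  exact exists_globalFlow_of_lipschitzWith_of_bounded (L := L.toNNReal) hC
    fun x => (hL x).trans (Real.le_coe_toNNReal L)

/-- Where `K` agrees with `p ↦ c * p.1`, the Hamiltonian vector field is `(0, c)`. -/
theorem hamVF_eq_of_eventuallyEq {K : ℝ × ℝ → ℝ} {c : ℝ} {p : ℝ × ℝ}
    (h : K =ᶠ[𝓝 p] fun q => c * q.1) : hamVF K p = (0, c) := by
  have hd : HasFDerivAt K (c • ContinuousLinearMap.fst ℝ ℝ ℝ) p :=
    HasFDerivAt.congr_of_eventuallyEq (hasFDerivAt_fst.const_mul c) h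
  simp [hamVF, hd.fderiv]

/-- A Hamiltonian flow translates vertically as long as the translated point stays where the
Hamiltonian vector field is `(0, c)`. -/
theorem IsHamFlow.eq_add_of_hamVF_eq {K : ℝ × ℝ → ℝ} {φ : ℝ → ℝ × ℝ → ℝ × ℝ}
    (hφ : IsHamFlow K φ) {C : ℝ≥0} (hC : LipschitzWith C (hamVF K)) {c T : ℝ} {p : ℝ × ℝ}
    (h : ∀ t ∈ Icc 0 T, hamVF K (p.1, p.2 + c * t) = (0, c)) {t : ℝ} (ht : t ∈ Icc 0 T) :
    φ t p = (p.1, p.2 + c * t) := by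
  have hline (s : ℝ) : HasDerivAt (fun s => (p.1, p.2 + c * s)) (0, c) s := by
    simpa using (hasDerivAt_const s p.1).prodMk
      (((hasDerivAt_id s).const_mul c).const_add p.2)
  refine ODE_solution_unique (v := fun _ => hamVF K) (a := 0) (b := T)
    (f := fun s => φ s p) (g := fun s => (p.1, p.2 + c * s)) (fun _ => hC)
    (HasDerivAt.continuousOn fun s _ => hφ.2 p s) (fun s _ => (hφ.2 p s).hasDerivWithinAt)
    (HasDerivAt.continuousOn fun s _ => hline s) (fun s hs => ?_) (by simp [hφ.1]) ht
  simpa only [h s (Ico_subset_Icc_self hs)] using (hline s).hasDerivWithinAt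

/-- A set with closure in an open square has a positive margin inside it. -/
theorem exists_margin_of_closure_subset {a : ℝ} (ha : 0 < a) {U : Set (ℝ × ℝ)}
    (hU : closure U ⊆ Ioo 0 a ×ˢ Ioo 0 a) :
    ∃ ε, 0 < ε ∧ ε < a / 2 ∧ U ⊆ Icc ε (a - ε) ×ˢ Icc ε (a - ε) := by
  have hcomp : IsCompact (closure U) :=
    (isCompact_Icc.prod isCompact_Icc).of_isClosed_subset isClosed_closure
      (hU.trans (prod_mono Ioo_subset_Icc_self Ioo_subset_Icc_self))
  obtain ⟨m, hm, hmU⟩ := hcomp.exists_forall_le'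
    (f := fun p : ℝ × ℝ => min (min p.1 (a - p.1)) (min p.2 (a - p.2)))
    (by fun_prop) (a := 0) (by
      intro p hp
      obtain ⟨⟨h1, h2⟩, h3, h4⟩ := hU hp
      simp only [lt_min_iff]
      exact ⟨⟨h1, by linarith⟩, h3, by linarith⟩)
  refine ⟨min m (a / 4), by positivity, by linarith [min_le_right m (a / 4)], fun p hp => ?_⟩
  have h := hmU p (subset_closure hp)
  simp only [le_min_iff] at h
  have := min_le_left m (a / 4)
  exact ⟨⟨by linarith, by linarith⟩, by linarith, by linarith⟩

/-- There is a smooth cutoff of `p ↦ (a - ε) * p.1` with support in `[0, a] × [0, 2a]`, unchanged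
at distance more than `ε / 2` from the boundary. -/
theorem exists_cutoff_hamiltonian {a ε : ℝ} (hε : 0 < ε) (hεa : ε < a / 2) :
    ∃ K : ℝ × ℝ → ℝ, ContDiff ℝ (⊤ : ℕ∞) K ∧ (∀ p, 0 ≤ K p) ∧
      Function.support K ⊆ Icc 0 a ×ˢ Icc 0 (2 * a) ∧ (∀ p, K p < a ^ 2) ∧
      ∀ p ∈ Ioo (ε / 2) (a - ε / 2) ×ˢ Ioo (ε / 2) (2 * a - ε / 2),
        K =ᶠ[𝓝 p] fun q => (a - ε) * q.1 := by
  let f : ContDiffBump (a / 2) := ⟨a / 2 - ε / 2, a / 2, by linarith, by linarith⟩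
  let g : ContDiffBump a := ⟨a - ε / 2, a, by linarith, by linarith⟩
  have hfz {x : ℝ} (hx : x ∉ Icc 0 a) : f x = 0 := by
    refine f.zero_of_le_dist (not_lt.1 fun h => hx ?_)
    rw [Real.dist_eq, abs_lt] at h
    change -(a / 2) < _ ∧ _ < a / 2 at h
    exact ⟨by linarith, by linarith⟩
  have hgz {y : ℝ} (hy : y ∉ Icc 0 (2 * a)) : g y = 0 := by
    refine g.zero_of_le_dist (not_lt.1 fun h => hy ?_)
    rw [Real.dist_eq, abs_lt] at h
    change -a < _ ∧ _ < a at h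
    exact ⟨by linarith, by linarith⟩
  refine ⟨fun p => (a - ε) * p.1 * (f p.1 * g p.2), ?_, fun p => ?_, fun p hp => ?_,
    fun p => ?_, fun p hp => ?_⟩
  · exact (contDiff_const.mul contDiff_fst).mul
      ((f.contDiff.comp contDiff_fst).mul (g.contDiff.comp contDiff_snd))
  · by_cases hx : p.1 ∈ Icc 0 a
    · exact mul_nonneg (mul_nonneg (by linarith) hx.1) (mul_nonneg f.nonneg g.nonneg)
    · simp [hfz hx]
  · by_contra h
    rw [mem_prod, not_and_or] at h
    rcases h with h | h
    · exact hp (by simp [hfz h])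
    · exact hp (by simp [hgz h])
  · by_cases hx : p.1 ∈ Icc 0 a
    · have h0 : 0 ≤ (a - ε) * p.1 := mul_nonneg (by linarith) hx.1
      calc (a - ε) * p.1 * (f p.1 * g p.2) ≤ (a - ε) * p.1 * 1 :=
            mul_le_mul_of_nonneg_left (mul_le_one₀ f.le_one g.nonneg g.le_one) h0
        _ < a ^ 2 := by nlinarith [hx.1, hx.2]
    · simp only [hfz hx, zero_mul, mul_zero]
      nlinarith
  · filter_upwards [(isOpen_Ioo.prod isOpen_Ioo).mem_nhds hp] with q hq
    obtain ⟨⟨h1, h2⟩, h3, h4⟩ := hq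
    have hf : f q.1 = 1 := f.one_of_mem_closedBall (by
      rw [mem_closedBall, Real.dist_eq, abs_le]
      change -(a / 2 - ε / 2) ≤ _ ∧ _ ≤ a / 2 - ε / 2
      constructor <;> linarith)
    have hg : g q.2 = 1 := g.one_of_mem_closedBall (by
      rw [mem_closedBall, Real.dist_eq, abs_le]
      change -(a - ε / 2) ≤ _ ∧ _ ≤ a - ε / 2
      constructor <;> linarith)
    simp [hf, hg]

/-- For every `δ > 0` and every `U ⊆ ℝ²` whose closure is contained in the interior of
the square `[0, √(π+δ)] × [0, √(π+δ)]`, there exist a smooth nonnegative function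
`K : ℝ² → ℝ` supported in `[0, √(π+δ)] × [0, 2√(π+δ)]`, with maximum value
less than `π + δ`, and a Hamiltonian flow `φ` of `K`, such that for every `t ∈ [0,1]`
the image `φᵗ(U)` lies in the interior of `[0, √(π+δ)] × [0, (1+t)√(π+δ)]`, and
`φ¹(U) ∩ U = ∅`. -/
theorem exists_pushing_hamiltonian_square (δ : ℝ) (hδ : 0 < δ) (U : Set (ℝ × ℝ))
    (hU : closure U ⊆ interior
      (Set.Icc (0 : ℝ) (Real.sqrt (Real.pi + δ)) ×ˢ
        Set.Icc (0 : ℝ) (Real.sqrt (Real.pi + δ)))) :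
    ∃ (K : ℝ × ℝ → ℝ) (φ : ℝ → ℝ × ℝ → ℝ × ℝ),
      ContDiff ℝ (⊤ : ℕ∞) K ∧ (∀ p, 0 ≤ K p) ∧
      Function.support K ⊆
        Set.Icc (0 : ℝ) (Real.sqrt (Real.pi + δ)) ×ˢ
          Set.Icc (0 : ℝ) (2 * Real.sqrt (Real.pi + δ)) ∧
      (∀ p, K p < Real.pi + δ) ∧
      IsHamFlow K φ ∧
      (∀ t ∈ Set.Icc (0 : ℝ) 1, φ t '' U ⊆ interior
        (Set.Icc (0 : ℝ) (Real.sqrt (Real.pi + δ)) ×ˢ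
          Set.Icc (0 : ℝ) ((1 + t) * Real.sqrt (Real.pi + δ)))) ∧
      φ 1 '' U ∩ U = ∅ := by
  set a := Real.sqrt (Real.pi + δ) with ha_def
  have hπ : 0 < Real.pi + δ := add_pos Real.pi_pos hδ
  have ha : 0 < a := Real.sqrt_pos.2 hπ
  have hsq : a ^ 2 = Real.pi + δ := Real.sq_sqrt hπ.le
  rw [interior_prod_eq, interior_Icc] at hU
  obtain ⟨ε, hε, hεa, hmargin⟩ := exists_margin_of_closure_subset ha hU
  obtain ⟨K, hK, hK0, hKsupp, hKlt, hKeq⟩ := exists_cutoff_hamiltonian hε hεa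
  have hc : HasCompactSupport K :=
    HasCompactSupport.of_support_subset_isCompact (isCompact_Icc.prod isCompact_Icc) hKsupp
  obtain ⟨φ, hφ⟩ := exists_isHamFlow hK hc
  obtain ⟨C, hC⟩ := (contDiff_hamVF hK).lipschitzWith_of_hasCompactSupport (hasCompactSupport_hamVF hc) one_ne_zero
  have htranslate {p : ℝ × ℝ} (hp : p ∈ U) {t : ℝ} (ht : t ∈ Icc (0 : ℝ) 1) :
      φ t p = (p.1, p.2 + (a - ε) * t) := by
    obtain ⟨⟨h1, h2⟩, h3, h4⟩ := hmargin hp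
    refine hφ.eq_add_of_hamVF_eq hC (fun s hs => hamVF_eq_of_eventuallyEq (hKeq _ ?_)) ht
    have hs0 : 0 ≤ (a - ε) * s := mul_nonneg (by linarith) hs.1
    have hs1 : (a - ε) * s ≤ a - ε := mul_le_of_le_one_right (by linarith) hs.2
    exact ⟨⟨by linarith, by linarith⟩, by simp only; linarith, by simp only; linarith⟩
  refine ⟨K, φ, hK, hK0, hKsupp, fun p => hsq ▸ hKlt p, hφ, ?_, ?_⟩
  · rintro t ht _ ⟨p, hp, rfl⟩
    obtain ⟨⟨h1, h2⟩, h3, h4⟩ := hmargin hp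
    rw [htranslate hp ht, interior_prod_eq, interior_Icc, interior_Icc]
    have ht0 : 0 ≤ (a - ε) * t := mul_nonneg (by linarith) ht.1
    have hεt : 0 ≤ ε * t := mul_nonneg hε.le ht.1
    exact ⟨⟨by linarith, by linarith⟩, by simp only; linarith, by simp only; linarith⟩
  · rw [← disjoint_iff_inter_eq_empty, disjoint_left]
    rintro _ ⟨p, hp, rfl⟩ hmem
    rw [htranslate hp (by simp)] at hmem
    have h3 := (hmargin hp).2.1
    have h4 := (hmargin hmem).2.2
    simp only at h4
    linarith
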